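/- arXiv:2110.00675 — 5 statements merged into one kernel-verified Lean document; each statement's English description precedes it below -/
import Mathlib

section
/- Let f : ℝⁿ → ℝⁿ be continuously differentiable with Jacobian A(x) = Df(x), and suppose there exists β > 0 such that for all x ∈ ℝⁿ and all v ∈ ℝⁿ, vᵀ(A(x) + A(x)ᵀ)v ≤ -β‖v‖². Then along every differentiable solution x : [0,∞) → ℝⁿ of ẋ = f(x), one has ‖f(x(t))‖ ≤ e^{-βt/2}‖f(x(0))‖ for all t ≥ 0. -/
open scoped Matrix RealInnerProductSpace

/-- **Grönwall's inequality** in differential form on `[0, ∞)`. -/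
theorem le_exp_mul_of_hasDerivAt_le_mul {V V' : ℝ → ℝ} {c : ℝ}
    (hV : ∀ t ≥ (0 : ℝ), HasDerivAt V (V' t) t) (hle : ∀ t ≥ (0 : ℝ), V' t ≤ c * V t)
    {t : ℝ} (ht : 0 ≤ t) : V t ≤ Real.exp (c * t) * V 0 := by
  have hW : ∀ s ≥ (0 : ℝ), HasDerivAt (fun s => Real.exp (-(c * s)) * V s)
      (Real.exp (-(c * s)) * (V' s - c * V s)) s := fun s hs => by
    have he : HasDerivAt (fun s => Real.exp (-(c * s))) (Real.exp (-(c * s)) * -(c * 1)) s :=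
      ((hasDerivAt_id s).const_mul c).neg.exp
    exact (he.mul (hV s hs)).congr_deriv (by ring)
  have hanti : AntitoneOn (fun s => Real.exp (-(c * s)) * V s) (Set.Ici 0) :=
    antitoneOn_of_hasDerivWithinAt_nonpos (convex_Ici 0)
      (fun s hs => (hW s hs).continuousAt.continuousWithinAt)
      (fun s hs => (hW s (interior_subset hs)).hasDerivWithinAt)
      fun s hs => mul_nonpos_of_nonneg_of_nonpos (Real.exp_pos _).le
        (sub_nonpos.2 (hle s (interior_subset hs)))
  have h : Real.exp (-(c * t)) * V t ≤ V 0 := by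
    simpa using hanti (Set.mem_Ici.2 le_rfl) (Set.mem_Ici.2 ht) ht
  calc V t = Real.exp (c * t) * (Real.exp (-(c * t)) * V t) := by
        rw [← mul_assoc, ← Real.exp_add, add_neg_cancel, Real.exp_zero, one_mul]
    _ ≤ Real.exp (c * t) * V 0 := by gcongr

/-- **Krasovskii-type global exponential contraction.**
If `f : ℝⁿ → ℝⁿ` is `C¹` with Jacobian `A(x) = Df(x)` and there is `β > 0` with
`vᵀ(A(x) + A(x)ᵀ)v ≤ -β‖v‖²` for all `x, v`, then along every solution of `ẋ = f(x)` one has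
`‖f(x(t))‖ ≤ e^{-βt/2}‖f(x(0))‖` for all `t ≥ 0`. -/
theorem krasovskii_contraction (n : ℕ)
    (f : EuclideanSpace ℝ (Fin n) → EuclideanSpace ℝ (Fin n))
    (hf : ContDiff ℝ 1 f) (β : ℝ) (hβ : 0 < β)
    (hneg : ∀ x v : EuclideanSpace ℝ (Fin n),
      ⟪(fderiv ℝ f x) v, v⟫ + ⟪v, (fderiv ℝ f x) v⟫ ≤ -β * ‖v‖ ^ 2)
    (x : ℝ → EuclideanSpace ℝ (Fin n))
    (hx : ∀ t ≥ (0 : ℝ), HasDerivAt x (f (x t)) t) :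
    ∀ t ≥ (0 : ℝ), ‖f (x t)‖ ≤ Real.exp (-β * t / 2) * ‖f (x 0)‖ := by
  intro t ht
  have hfx : ∀ s ≥ (0 : ℝ),
      HasDerivAt (fun s => f (x s)) (fderiv ℝ f (x s) (f (x s))) s := fun s hs =>
    ((hf.differentiable one_ne_zero) (x s)).hasFDerivAt.comp_hasDerivAt s (hx s hs)
  have hV := le_exp_mul_of_hasDerivAt_le_mul (V := fun s => ⟪f (x s), f (x s)⟫) (c := -β)
    (fun s hs => (hfx s hs).inner ℝ (hfx s hs))
    (fun s _ => by
      rw [real_inner_self_eq_norm_sq, add_comm]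
      exact hneg (x s) (f (x s))) ht
  simp only [real_inner_self_eq_norm_sq] at hV
  refine (sq_le_sq₀ (norm_nonneg _) (by positivity)).1 ?_
  rwa [mul_pow, ← Real.exp_nat_mul, Nat.cast_ofNat, mul_div_cancel₀ _ two_ne_zero]
end

section
/- Let a₁, c : [0,∞) → ℝ be continuously differentiable with a₁(t) ≥ α > 0, c(t) > 0, and ċ(t) ≥ 2μ c(t) for some μ > 0 and all t ≥ 0. Let ξ : [0,∞) → ℝ be twice differentiable and satisfy the variational equation ξ̈(t) + a₁(t) ξ̇(t) + ( ȧ₁(t) + c(t) ) ξ(t) = 0 for all t ≥ 0. Then the quantity V(t) := ξ(t)² + ( a₁(t) ξ(t) + ξ̇(t) )² / c(t) satisfies V(t) ≤ V(0) · e^{-2 min(α, μ) t} for all t ≥ 0. -/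
/-- Differential form of Grönwall's inequality on `[0, ∞)`: if `V' ≤ -k V` then
`V t ≤ V 0 * exp (-k t)`. -/
theorem le_mul_exp_of_hasDerivAt_le {V V' : ℝ → ℝ} {k : ℝ}
    (hV : ∀ t ≥ (0 : ℝ), HasDerivAt V (V' t) t) (hle : ∀ t ≥ (0 : ℝ), V' t ≤ -k * V t) :
    ∀ t ≥ (0 : ℝ), V t ≤ V 0 * Real.exp (-k * t) := by
  have hW : ∀ t ≥ (0 : ℝ), HasDerivAt (fun s => V s * Real.exp (k * s))
      ((V' t + k * V t) * Real.exp (k * t)) t := fun t ht => by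
    refine ((hV t ht).mul ((hasDerivAt_id t).const_mul k).exp).congr_deriv ?_
    simp only [id]
    ring
  have hanti : AntitoneOn (fun s => V s * Real.exp (k * s)) (Set.Ici 0) := by
    refine antitoneOn_of_deriv_nonpos (convex_Ici 0)
      (fun t ht => (hW t ht).continuousAt.continuousWithinAt)
      (fun t ht => (hW t (interior_subset ht)).differentiableAt.differentiableWithinAt)
      fun t ht => ?_
    have ht' : t ≥ 0 := interior_subset ht
    rw [(hW t ht').deriv]
    exact mul_nonpos_of_nonpos_of_nonneg (by linarith [hle t ht']) (Real.exp_pos _).le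
  intro t ht
  have h : V t * Real.exp (k * t) ≤ V 0 := by
    simpa using hanti Set.self_mem_Ici ht ht
  rwa [neg_mul, Real.exp_neg, ← div_eq_mul_inv, le_div_iff₀ (Real.exp_pos _)]

/-- **High-order contraction estimate for second-order systems.**
Let `a₁, c : [0,∞) → ℝ` be `C¹` with `a₁(t) ≥ α > 0`, `c(t) > 0` and `ċ(t) ≥ 2μc(t)`
(`μ > 0`). If `ξ` satisfies the variational equation
`ξ̈ + a₁ξ̇ + (ȧ₁ + c)ξ = 0`, then `V(t) = ξ² + (a₁ξ + ξ̇)²/c` satisfies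
`V(t) ≤ V(0)e^{-2 min(α,μ) t}` for all `t ≥ 0`. -/
theorem high_order_contraction (a₁ c : ℝ → ℝ) (α μ : ℝ) (hα : 0 < α) (hμ : 0 < μ)
    (ha₁_smooth : ContDiff ℝ 1 a₁) (hc_smooth : ContDiff ℝ 1 c)
    (ha₁_lb : ∀ t ≥ (0 : ℝ), α ≤ a₁ t)
    (hc_pos : ∀ t ≥ (0 : ℝ), 0 < c t)
    (hc_growth : ∀ t ≥ (0 : ℝ), 2 * μ * c t ≤ deriv c t)
    (ξ ξ' : ℝ → ℝ)
    (hξ : ∀ t ≥ (0 : ℝ), HasDerivAt ξ (ξ' t) t)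
    (hξ' : ∀ t ≥ (0 : ℝ),
      HasDerivAt ξ' (-(a₁ t * ξ' t) - (deriv a₁ t + c t) * ξ t) t) :
    ∀ t ≥ (0 : ℝ),
      ξ t ^ 2 + (a₁ t * ξ t + ξ' t) ^ 2 / c t ≤
        (ξ 0 ^ 2 + (a₁ 0 * ξ 0 + ξ' 0) ^ 2 / c 0) * Real.exp (-2 * min α μ * t) := by
  have hy : ∀ t ≥ (0 : ℝ),
      HasDerivAt (fun s => a₁ s * ξ s + ξ' s) (-(c t * ξ t)) t := fun t ht => by
    have ha : HasDerivAt a₁ (deriv a₁ t) t :=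
      ((ha₁_smooth.differentiable one_ne_zero) t).hasDerivAt
    refine ((ha.mul (hξ t ht)).add (hξ' t ht)).congr_deriv ?_
    ring
  have hV : ∀ t ≥ (0 : ℝ),
      HasDerivAt (fun s => ξ s ^ 2 + (a₁ s * ξ s + ξ' s) ^ 2 / c s)
        (-2 * a₁ t * ξ t ^ 2 - (a₁ t * ξ t + ξ' t) ^ 2 * deriv c t / c t ^ 2) t :=
      fun t ht => by
    have hc : HasDerivAt c (deriv c t) t :=
      ((hc_smooth.differentiable one_ne_zero) t).hasDerivAt
    have hct := (hc_pos t ht).ne'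
    refine (((hξ t ht).pow 2).add (((hy t ht).pow 2).div hc hct)).congr_deriv ?_
    simp only [Pi.pow_apply]
    field_simp
    ring
  have hdecay : ∀ t ≥ (0 : ℝ),
      -2 * a₁ t * ξ t ^ 2 - (a₁ t * ξ t + ξ' t) ^ 2 * deriv c t / c t ^ 2 ≤
        -(2 * min α μ) * (ξ t ^ 2 + (a₁ t * ξ t + ξ' t) ^ 2 / c t) := fun t ht => by
    have hct := hc_pos t ht
    have h₁ : min α μ * ξ t ^ 2 ≤ a₁ t * ξ t ^ 2 :=
      mul_le_mul_of_nonneg_right ((min_le_left α μ).trans (ha₁_lb t ht)) (sq_nonneg _)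
    have h₂ : 2 * min α μ * ((a₁ t * ξ t + ξ' t) ^ 2 / c t) ≤
        (a₁ t * ξ t + ξ' t) ^ 2 * deriv c t / c t ^ 2 := by
      have hmin : 2 * min α μ * c t ≤ deriv c t :=
        (mul_le_mul_of_nonneg_right (by linarith [min_le_right α μ]) hct.le).trans
          (hc_growth t ht)
      calc 2 * min α μ * ((a₁ t * ξ t + ξ' t) ^ 2 / c t)
          = (a₁ t * ξ t + ξ' t) ^ 2 * (2 * min α μ * c t) / c t ^ 2 := by field_simp
        _ ≤ _ := by gcongr
    linarith
  simpa only [neg_mul] using le_mul_exp_of_hasDerivAt_le hV hdecay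
end

section
/- Let J ∈ Matrix (Fin 3) (Fin 3) ℝ be symmetric with j‖v‖² ≤ vᵀJv ≤ j̄‖v‖² for constants 0 < j ≤ j̄ and all v. Let A : [0,∞) → Matrix (Fin 3) (Fin 3) ℝ be continuous with A(t) skew-symmetric for every t, let K be symmetric with vᵀKv ≥ k‖v‖², k > 0, and let d : [0,∞) → ℝ³ be continuous with ‖d(t)‖ ≤ D for all t. Then every differentiable ω : [0,∞) → ℝ³ satisfying J ω'(t) = A(t) ω(t) - K ω(t) + d(t) obeys: (i) if D = 0, ω(t)ᵀ J ω(t) ≤ e^{-2(k/j̄)t} · ω(0)ᵀ J ω(0), so ω converges globally exponentially to zero at rate k/j̄; (ii) in general, limsup_{t→∞} ‖ω(t)‖ ≤ (j̄/(k·j)) · D. -/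
open scoped Matrix

/-- Comparison principle for the scalar differential inequality `f' ≤ -c (f - M)`. -/
theorem le_add_exp_mul_of_hasDerivAt_le {f f' : ℝ → ℝ} {c M : ℝ}
    (hf : ∀ t, HasDerivAt f (f' t) t) (hle : ∀ t, f' t ≤ -c * (f t - M)) {t : ℝ} (ht : 0 ≤ t) :
    f t ≤ M + Real.exp (-c * t) * (f 0 - M) := by
  have hg : ∀ s, HasDerivAt (fun s => Real.exp (c * s) * (f s - M))
      (Real.exp (c * s) * c * (f s - M) + Real.exp (c * s) * f' s) s := fun s => by
    have h := ((hasDerivAt_id s).const_mul c).exp.fun_mul ((hf s).sub_const M)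
    simpa using h
  have hanti : Antitone fun s => Real.exp (c * s) * (f s - M) :=
    antitone_of_hasDerivAt_nonpos hg fun s => by
      have h := mul_le_mul_of_nonneg_left (hle s) (Real.exp_pos (c * s)).le
      rw [Pi.zero_apply]
      linarith
  have h0 : Real.exp (c * t) * (f t - M) ≤ f 0 - M := by simpa using hanti ht
  have h1 := mul_le_mul_of_nonneg_left h0 (Real.exp_pos (-c * t)).le
  rw [← mul_assoc, ← Real.exp_add, neg_mul, neg_add_cancel, Real.exp_zero, one_mul] at h1
  rw [neg_mul]
  linarith

theorem Matrix.dotProduct_mulVec_self_of_transpose_eq_neg {n : Type*} [Fintype n]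
    {A : Matrix n n ℝ} (hA : Aᵀ = -A) (v : n → ℝ) : v ⬝ᵥ (A *ᵥ v) = 0 := by
  have h : v ⬝ᵥ (A *ᵥ v) = -(v ⬝ᵥ (A *ᵥ v)) := by
    conv_lhs => rw [Matrix.dotProduct_mulVec, ← Matrix.mulVec_transpose, hA, Matrix.neg_mulVec,
      neg_dotProduct, dotProduct_comm]
  linarith

theorem HasDerivAt.dotProduct_mulVec_self {n : Type*} [Fintype n] {J : Matrix n n ℝ}
    (hJ : J.IsSymm) {f : ℝ → EuclideanSpace ℝ n} {f' : EuclideanSpace ℝ n} {t : ℝ}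
    (hf : HasDerivAt f f' t) :
    HasDerivAt (fun s => f s ⬝ᵥ (J *ᵥ f s)) (2 * (f t ⬝ᵥ (J *ᵥ f'))) t := by
  have hi : ∀ i, HasDerivAt (fun s => f s i) (f' i) t := fun i =>
    (EuclideanSpace.proj (𝕜 := ℝ) i).hasFDerivAt.comp_hasDerivAt t hf
  have hs : (f' : n → ℝ) ⬝ᵥ (J *ᵥ f t) = f t ⬝ᵥ (J *ᵥ f') := by
    rw [dotProduct_comm, Matrix.dotProduct_mulVec (f t : n → ℝ), ← Matrix.mulVec_transpose, hJ.eq]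
  have h : HasDerivAt (fun s => f s ⬝ᵥ (J *ᵥ f s))
      ((f' : n → ℝ) ⬝ᵥ (J *ᵥ f t) + f t ⬝ᵥ (J *ᵥ f')) t := by
    simp only [dotProduct, Matrix.mulVec, ← Finset.sum_add_distrib]
    exact HasDerivAt.fun_sum fun i _ =>
      (hi i).mul (HasDerivAt.fun_sum fun k _ => (hi k).const_mul (J i k))
  rwa [hs, ← two_mul] at h

/-- **Robust nonlinear attitude control: closed-loop error dynamics.**
For `J ω̇ = A(t)ω - Kω + d` with `J` symmetric, `j‖v‖² ≤ vᵀJv ≤ j̄‖v‖²`, `A(t)`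
skew-symmetric, `K` symmetric with `vᵀKv ≥ k‖v‖²` (`k > 0`) and `‖d(t)‖ ≤ D`:
(i) if `D = 0` then `ω(t)ᵀJω(t) ≤ e^{-2(k/j̄)t} ω(0)ᵀJω(0)` (global exponential
convergence to zero at rate `k/j̄`); (ii) in general
`limsup_{t→∞} ‖ω(t)‖ ≤ (j̄/(k·j))·D`. -/
theorem attitude_error_dynamics
    (J : Matrix (Fin 3) (Fin 3) ℝ) (hJ_symm : J.IsSymm)
    (j jbar : ℝ) (hj : 0 < j) (hjjbar : j ≤ jbar)
    (hJ_bounds : ∀ v : EuclideanSpace ℝ (Fin 3),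
      j * ‖v‖ ^ 2 ≤ v ⬝ᵥ (J *ᵥ v) ∧ v ⬝ᵥ (J *ᵥ v) ≤ jbar * ‖v‖ ^ 2)
    (A : ℝ → Matrix (Fin 3) (Fin 3) ℝ) (hA_cont : Continuous A)
    (hA_skew : ∀ t : ℝ, (A t)ᵀ = -A t)
    (K : Matrix (Fin 3) (Fin 3) ℝ) (hK_symm : K.IsSymm)
    (k : ℝ) (hk : 0 < k)
    (hK : ∀ v : EuclideanSpace ℝ (Fin 3), k * ‖v‖ ^ 2 ≤ v ⬝ᵥ (K *ᵥ v))
    (d : ℝ → EuclideanSpace ℝ (Fin 3)) (hd_cont : Continuous d)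
    (D : ℝ) (hD : ∀ t : ℝ, ‖d t‖ ≤ D)
    (ω ω' : ℝ → EuclideanSpace ℝ (Fin 3))
    (hω : ∀ t : ℝ, HasDerivAt ω (ω' t) t)
    (heq : ∀ t : ℝ, J *ᵥ ω' t = A t *ᵥ ω t - K *ᵥ ω t + (show Fin 3 → ℝ from d t)) :
    (D = 0 → ∀ t ≥ (0 : ℝ),
      ω t ⬝ᵥ (J *ᵥ ω t) ≤ Real.exp (-2 * (k / jbar) * t) * (ω 0 ⬝ᵥ (J *ᵥ ω 0)))
    ∧ Filter.limsup (fun t => ‖ω t‖) Filter.atTop ≤ jbar / (k * j) * D := by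
  have hjbar : 0 < jbar := hj.trans_le hjjbar
  have hD0 : 0 ≤ D := (norm_nonneg _).trans (hD 0)
  have hV : ∀ t, HasDerivAt (fun s => ω s ⬝ᵥ (J *ᵥ ω s)) (2 * (ω t ⬝ᵥ (J *ᵥ ω' t))) t :=
    fun t => (hω t).dotProduct_mulVec_self hJ_symm
  have hdiss : ∀ t, ω t ⬝ᵥ (J *ᵥ ω' t) ≤ -k * ‖ω t‖ ^ 2 + D * ‖ω t‖ := fun t => by
    have hd : (ω t : Fin 3 → ℝ) ⬝ᵥ (d t : Fin 3 → ℝ) ≤ D * ‖ω t‖ := by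
      have h : inner ℝ (d t) (ω t) = (ω t : Fin 3 → ℝ) ⬝ᵥ (d t : Fin 3 → ℝ) := by
        simp [EuclideanSpace.inner_eq_star_dotProduct]
      rw [← h]
      exact (real_inner_le_norm _ _).trans (by gcongr; exact hD t)
    rw [heq t, dotProduct_add, dotProduct_sub,
      Matrix.dotProduct_mulVec_self_of_transpose_eq_neg (hA_skew t)]
    linarith [hK (ω t)]
  constructor
  · rintro rfl t ht
    have h := le_add_exp_mul_of_hasDerivAt_le (c := 2 * (k / jbar)) (M := 0) hV (fun s => by
      have h1 : k / jbar * (ω s ⬝ᵥ (J *ᵥ ω s)) ≤ k * ‖ω s‖ ^ 2 := by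
        rw [div_mul_eq_mul_div, div_le_iff₀ hjbar]
        nlinarith [(hJ_bounds (ω s)).2]
      linarith [hdiss s]) ht
    simpa using h
  · set M := jbar * (D / k) ^ 2 with hM
    set c := k / jbar with hc
    have hcpos : 0 < c := by positivity
    have hVle : ∀ t, 0 ≤ t → ω t ⬝ᵥ (J *ᵥ ω t) ≤
        M + Real.exp (-c * t) * (ω 0 ⬝ᵥ (J *ᵥ ω 0) - M) := fun t ht =>
      le_add_exp_mul_of_hasDerivAt_le hV (fun s => by
        have h1 : c * (ω s ⬝ᵥ (J *ᵥ ω s)) ≤ k * ‖ω s‖ ^ 2 := by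
          rw [hc, div_mul_eq_mul_div, div_le_iff₀ hjbar]
          nlinarith [(hJ_bounds (ω s)).2]
        have h2 : c * M = k * (D / k) ^ 2 := by rw [hc, hM]; field_simp
        have h3 : D = k * (D / k) := by field_simp
        have h4 : 2 * (D * ‖ω s‖) ≤ k * ‖ω s‖ ^ 2 + k * (D / k) ^ 2 := by
          conv_lhs => rw [h3]
          nlinarith [mul_nonneg hk.le (sq_nonneg (‖ω s‖ - D / k))]
        linarith [hdiss s]) ht
    have hlim : Filter.Tendsto
        (fun t => √((M + Real.exp (-c * t) * (ω 0 ⬝ᵥ (J *ᵥ ω 0) - M)) / j))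
        Filter.atTop (nhds √(M / j)) := by
      have he : Filter.Tendsto (fun t => Real.exp (-c * t)) Filter.atTop (nhds 0) :=
        Real.tendsto_exp_atBot.comp
          (Filter.tendsto_id.const_mul_atTop_of_neg (neg_lt_zero.2 hcpos))
      have h := (((he.mul_const (ω 0 ⬝ᵥ (J *ᵥ ω 0) - M)).const_add M).div_const j).sqrt
      simpa using h
    have hle : (fun t => ‖ω t‖) ≤ᶠ[Filter.atTop]
        fun t => √((M + Real.exp (-c * t) * (ω 0 ⬝ᵥ (J *ᵥ ω 0) - M)) / j) := by
      filter_upwards [Filter.eventually_ge_atTop 0] with t ht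
      apply Real.le_sqrt_of_sq_le
      rw [le_div_iff₀ hj]
      linarith [(hJ_bounds (ω t)).1, hVle t ht]
    calc Filter.limsup (fun t => ‖ω t‖) Filter.atTop
        ≤ Filter.limsup
            (fun t => √((M + Real.exp (-c * t) * (ω 0 ⬝ᵥ (J *ᵥ ω 0) - M)) / j)) Filter.atTop :=
          Filter.limsup_le_limsup hle
            (Filter.isCoboundedUnder_le_of_le _ fun t => norm_nonneg (ω t))
            hlim.isBoundedUnder_le
      _ = √(M / j) := hlim.limsup_eq
      _ ≤ jbar / (k * j) * D := by
          apply Real.sqrt_le_iff.2 ⟨by positivity, ?_⟩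
          have h1 : M / j = jbar / j * (D / k) ^ 2 := by rw [hM]; ring
          have h2 : (jbar / (k * j) * D) ^ 2 = (jbar / j) ^ 2 * (D / k) ^ 2 := by
            field_simp
          rw [h1, h2]
          gcongr
          exact le_self_pow₀ ((one_le_div hj).2 hjjbar) two_ne_zero
end

section
/- Let k : [0,∞) → ℝ be continuous with k(t) ≥ k₀ > 0 for all t, and let θ : [0,∞) → ℝ be differentiable with θ'(t) = -k(t) sin(θ(t)) for all t ≥ 0 and |θ(0)| < π. Then |θ(t)| < π for all t ≥ 0, tan(θ(t)/2) = e^{-∫₀ᵗ k(s)ds} · tan(θ(0)/2) for all t ≥ 0, and hence |tan(θ(t)/2)| ≤ e^{-k₀ t} |tan(θ(0)/2)| and θ(t) → 0 as t → ∞. -/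
open Real

/-- Solutions on `[0, ∞)` of the scalar linear equation `y' = g y` with continuous `g`. -/
theorem eq_exp_integral_mul_of_hasDerivAt {g y : ℝ → ℝ} (hg : Continuous g)
    (hy : ∀ t ≥ (0 : ℝ), HasDerivAt y (g t * y t) t) {t : ℝ} (ht : 0 ≤ t) :
    y t = Real.exp (∫ s in (0 : ℝ)..t, g s) * y 0 := by
  have hz : ∀ x ≥ (0 : ℝ),
      HasDerivAt (fun x => y x * Real.exp (-∫ s in (0 : ℝ)..x, g s)) 0 x := by
    intro x hx
    have hG : HasDerivAt (fun x => ∫ s in (0 : ℝ)..x, g s) (g x) x :=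
      hg.integral_hasStrictDerivAt 0 x |>.hasDerivAt
    refine ((hy x hx).mul hG.neg.exp).congr_deriv ?_
    ring
  have h := constant_of_has_deriv_right_zero
    (fun x hx => (hz x hx.1).continuousAt.continuousWithinAt)
    (fun x hx => (hz x hx.1).hasDerivWithinAt) t ⟨ht, le_rfl⟩
  simp only [intervalIntegral.integral_same, neg_zero, Real.exp_zero, mul_one] at h
  rw [← h, mul_left_comm, ← Real.exp_add, add_neg_cancel, Real.exp_zero, mul_one]

/-- A solution of `θ' = -k sin θ` starting in `(-π, π)` keeps `cos (θ / 2)` positive. -/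
theorem cos_half_pos_of_hasDerivAt {k θ : ℝ → ℝ} (hk : Continuous k)
    (hθ : ∀ t ≥ (0 : ℝ), HasDerivAt θ (-k t * Real.sin (θ t)) t)
    (h0 : |θ 0| < π) {t : ℝ} (ht : 0 ≤ t) : 0 < Real.cos (θ t / 2) := by
  have hcont : Continuous fun t => θ (max t 0) := continuous_iff_continuousAt.2 fun t =>
    ContinuousAt.comp (f := fun t : ℝ => max t 0) (hθ _ (le_max_right t 0)).continuousAt
      (by fun_prop)
  have hg : Continuous fun t => k t * Real.sin (θ (max t 0) / 2) ^ 2 :=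
    hk.mul ((Real.continuous_sin.comp (hcont.div_const 2)).pow 2)
  have hy : ∀ t ≥ (0 : ℝ), HasDerivAt (fun t => Real.cos (θ t / 2))
      (k t * Real.sin (θ (max t 0) / 2) ^ 2 * Real.cos (θ t / 2)) t := by
    intro t ht
    refine ((hθ t ht).div_const 2).cos.congr_deriv ?_
    have h2 : Real.sin (θ t) = 2 * Real.sin (θ t / 2) * Real.cos (θ t / 2) := by
      rw [← Real.sin_two_mul, mul_div_cancel₀ _ two_ne_zero]
    rw [max_eq_left ht, h2]
    ring
  rw [eq_exp_integral_mul_of_hasDerivAt hg hy ht]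
  have := abs_lt.1 h0
  exact mul_pos (Real.exp_pos _) (Real.cos_pos_of_mem_Ioo ⟨by linarith, by linarith⟩)

/-- **Exponential convergence of `θ̇ = -k(t)sin(θ)` via the `tan(θ/2)` coordinate.**
If `k` is continuous with `k(t) ≥ k₀ > 0` and `θ` solves `θ̇ = -k(t)sin(θ)` with
`|θ(0)| < π`, then `|θ(t)| < π` for all `t ≥ 0`,
`tan(θ(t)/2) = e^{-∫₀ᵗ k} tan(θ(0)/2)`, hence
`|tan(θ(t)/2)| ≤ e^{-k₀t}|tan(θ(0)/2)|` and `θ(t) → 0` as `t → ∞`. -/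
theorem sine_system_contraction (k : ℝ → ℝ) (k₀ : ℝ) (hk₀ : 0 < k₀)
    (hk_cont : Continuous k) (hk_lb : ∀ t ≥ (0 : ℝ), k₀ ≤ k t)
    (θ : ℝ → ℝ)
    (hθ : ∀ t ≥ (0 : ℝ), HasDerivAt θ (-k t * Real.sin (θ t)) t)
    (h0 : |θ 0| < π) :
    (∀ t ≥ (0 : ℝ), |θ t| < π)
    ∧ (∀ t ≥ (0 : ℝ),
        Real.tan (θ t / 2) = Real.exp (-∫ s in (0 : ℝ)..t, k s) * Real.tan (θ 0 / 2))
    ∧ (∀ t ≥ (0 : ℝ), |Real.tan (θ t / 2)| ≤ Real.exp (-k₀ * t) * |Real.tan (θ 0 / 2)|)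
    ∧ Filter.Tendsto θ Filter.atTop (nhds 0) := by
  have hcos : ∀ t ≥ (0 : ℝ), 0 < Real.cos (θ t / 2) := fun t ht =>
    cos_half_pos_of_hasDerivAt hk_cont hθ h0 ht
  have hlt : ∀ t ≥ (0 : ℝ), |θ t| < π := by
    intro t ht
    by_contra! h
    have hc : ContinuousOn (fun s => |θ s|) (Set.Icc 0 t) := fun s hs =>
      (hθ s hs.1).continuousAt.abs.continuousWithinAt
    obtain ⟨s, hs, hsπ⟩ := intermediate_value_Icc ht hc ⟨h0.le, h⟩
    have hs' : |θ s| = π := hsπ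
    have hpos := hcos s hs.1
    rw [← Real.cos_abs, abs_div, hs', abs_two, Real.cos_pi_div_two] at hpos
    exact hpos.false
  have htan : ∀ t ≥ (0 : ℝ),
      Real.tan (θ t / 2) = Real.exp (-∫ s in (0 : ℝ)..t, k s) * Real.tan (θ 0 / 2) := by
    intro t ht
    rw [← intervalIntegral.integral_neg]
    refine eq_exp_integral_mul_of_hasDerivAt (g := fun s => -k s)
      (y := fun s => Real.tan (θ s / 2)) hk_cont.neg (fun s hs => ?_) ht
    have hne := (hcos s hs).ne'
    refine ((Real.hasDerivAt_tan hne).comp s ((hθ s hs).div_const 2)).congr_deriv ?_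
    have h2 : Real.sin (θ s) = 2 * Real.sin (θ s / 2) * Real.cos (θ s / 2) := by
      rw [← Real.sin_two_mul, mul_div_cancel₀ _ two_ne_zero]
    rw [h2, Real.tan_eq_sin_div_cos]
    field_simp
  have hbound : ∀ t ≥ (0 : ℝ),
      |Real.tan (θ t / 2)| ≤ Real.exp (-k₀ * t) * |Real.tan (θ 0 / 2)| := by
    intro t ht
    rw [htan t ht, abs_mul, Real.abs_exp]
    have hint : ∫ _ in (0 : ℝ)..t, k₀ ≤ ∫ s in (0 : ℝ)..t, k s :=
      intervalIntegral.integral_mono_on ht (by simp) (hk_cont.intervalIntegrable 0 t)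
        fun s hs => hk_lb s hs.1
    rw [intervalIntegral.integral_const, smul_eq_mul, sub_zero] at hint
    gcongr
    linarith
  refine ⟨hlt, htan, hbound, ?_⟩
  have hexp : Filter.Tendsto (fun t => Real.exp (-k₀ * t) * |Real.tan (θ 0 / 2)|)
      Filter.atTop (nhds 0) := by
    simpa using (Real.tendsto_exp_atBot.comp
      (Filter.tendsto_id.const_mul_atTop_of_neg (neg_lt_zero.2 hk₀))).mul_const
        |Real.tan (θ 0 / 2)|
  have htan0 : Filter.Tendsto (fun t => Real.tan (θ t / 2)) Filter.atTop (nhds 0) :=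
    squeeze_zero_norm' ((Filter.eventually_ge_atTop 0).mono hbound) hexp
  have harctan := ((Real.continuous_arctan.tendsto 0).comp htan0).const_mul 2
  rw [Real.arctan_zero, mul_zero] at harctan
  refine harctan.congr' ((Filter.eventually_ge_atTop 0).mono fun t ht => ?_)
  have := abs_lt.1 (hlt t ht)
  rw [Function.comp_apply, Real.arctan_tan (by linarith) (by linarith),
    mul_div_cancel₀ _ two_ne_zero]
end

section
/- Let V : ℝⁿ → ℝ be twice continuously differentiable and suppose there exists λ > 0 such that the Hessian satisfies wᵀ(HessV(x))w ≥ λ‖w‖² for all x, w ∈ ℝⁿ (λ-strong convexity). Then any two differentiable solutions x₁, x₂ : [0,∞) → ℝⁿ of the gradient system ẋ = -∇V(x) satisfy ‖x₁(t) - x₂(t)‖ ≤ e^{-λt} ‖x₁(0) - x₂(0)‖ for all t ≥ 0. -/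
open scoped RealInnerProductSpace

section

variable {E : Type*} [NormedAddCommGroup E] [InnerProductSpace ℝ E]

/-- The gradient of a `C²` function is differentiable. -/
theorem ContDiff.differentiable_gradient [CompleteSpace E] {V : E → ℝ} (hV : ContDiff ℝ 2 V) :
    Differentiable ℝ (gradient V) := by
  have h : Differentiable ℝ (fderiv ℝ V) :=
    (hV.fderiv_right (m := 1) (by norm_num)).differentiable (by norm_num)
  exact (InnerProductSpace.toDual ℝ E).symm.toContinuousLinearEquiv.differentiable.comp h

/-- A vector field whose derivative is bounded below by `c` in the sense of quadratic forms is
`c`-strongly monotone. -/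
theorem mul_norm_sub_sq_le_inner_of_le_inner_fderiv {F : E → E} (hF : Differentiable ℝ F) {c : ℝ}
    (h : ∀ x w : E, c * ‖w‖ ^ 2 ≤ ⟪w, fderiv ℝ F x w⟫) (x y : E) :
    c * ‖x - y‖ ^ 2 ≤ ⟪x - y, F x - F y⟫ := by
  have hline (s : ℝ) : HasDerivAt (fun s : ℝ => y + s • (x - y)) (x - y) s := by
    simpa using ((hasDerivAt_id s).smul_const (x - y)).const_add y
  have hg (s : ℝ) : HasDerivAt (fun s : ℝ => ⟪x - y, F (y + s • (x - y))⟫)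
      ⟪x - y, fderiv ℝ F (y + s • (x - y)) (x - y)⟫ s := by
    simpa using (hasDerivAt_const s (x - y)).inner ℝ
      ((hF (y + s • (x - y))).hasFDerivAt.comp_hasDerivAt s (hline s))
  have key := mul_sub_le_image_sub_of_le_deriv (fun s => (hg s).differentiableAt)
    (fun s => (h _ _).trans_eq (hg s).deriv.symm) zero_le_one
  simpa [inner_sub_right] using key

/-- Forward solutions of `ẋ = -F x` contract exponentially at rate `c` if `F` is `c`-strongly
monotone. -/
theorem norm_sub_le_exp_mul_of_stronglyMonotone {F : E → E} {c : ℝ}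
    (hF : ∀ x y : E, c * ‖x - y‖ ^ 2 ≤ ⟪x - y, F x - F y⟫) {x₁ x₂ : ℝ → E}
    (hx₁ : ∀ t ≥ (0 : ℝ), HasDerivAt x₁ (-F (x₁ t)) t)
    (hx₂ : ∀ t ≥ (0 : ℝ), HasDerivAt x₂ (-F (x₂ t)) t) {t : ℝ} (ht : 0 ≤ t) :
    ‖x₁ t - x₂ t‖ ≤ Real.exp (-c * t) * ‖x₁ 0 - x₂ 0‖ := by
  have hexp (s : ℝ) : HasDerivAt (fun s => Real.exp (c * s)) (Real.exp (c * s) * c) s := by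
    simpa using ((hasDerivAt_id s).const_mul c).exp
  have hu (s : ℝ) (hs : 0 ≤ s) := ((hexp s).pow 2).mul ((hx₁ s hs).sub (hx₂ s hs)).norm_sq
  have hanti : AntitoneOn (fun s => Real.exp (c * s) ^ 2 * ‖x₁ s - x₂ s‖ ^ 2) (Set.Ici 0) := by
    refine antitoneOn_of_deriv_nonpos (convex_Ici 0)
      (fun s hs => (hu s hs).continuousAt.continuousWithinAt)
      (fun s hs => (hu s (interior_subset hs)).differentiableAt.differentiableWithinAt)
      fun s hs => ?_
    refine (hu s (interior_subset hs)).deriv.trans_le ?_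
    have hinner : ⟪x₁ s - x₂ s, -F (x₁ s) - -F (x₂ s)⟫ =
        -⟪x₁ s - x₂ s, F (x₁ s) - F (x₂ s)⟫ := by
      rw [← inner_neg_right]
      congr 1
      abel
    simp only [Pi.sub_apply, Pi.pow_apply, hinner]
    have := mul_le_mul_of_nonneg_left (hF (x₁ s) (x₂ s)) (sq_nonneg (Real.exp (c * s)))
    norm_num
    linarith
  have hsq := hanti Set.self_mem_Ici ht ht
  simp only [← mul_pow, mul_zero, Real.exp_zero, one_mul] at hsq
  have hle := (pow_le_pow_iff_left₀ (by positivity) (by positivity) two_ne_zero).1 hsq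
  rwa [neg_mul, Real.exp_neg, ← div_eq_inv_mul, le_div_iff₀' (Real.exp_pos _)]

end

/-- **Contraction of gradient flows of strongly convex functions.**
If `V : ℝⁿ → ℝ` is `C²` and `λ`-strongly convex (`wᵀ(HessV(x))w ≥ λ‖w‖²`), then any two
solutions of the gradient system `ẋ = -∇V(x)` satisfy
`‖x₁(t) - x₂(t)‖ ≤ e^{-λt}‖x₁(0) - x₂(0)‖` for all `t ≥ 0`. -/
theorem gradient_flow_contraction (n : ℕ)
    (V : EuclideanSpace ℝ (Fin n) → ℝ) (hV : ContDiff ℝ 2 V)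
    (lam : ℝ) (hlam : 0 < lam)
    (hconv : ∀ x w : EuclideanSpace ℝ (Fin n),
      lam * ‖w‖ ^ 2 ≤ ⟪w, (fderiv ℝ (gradient V) x) w⟫)
    (x₁ x₂ : ℝ → EuclideanSpace ℝ (Fin n))
    (hx₁ : ∀ t ≥ (0 : ℝ), HasDerivAt x₁ (-gradient V (x₁ t)) t)
    (hx₂ : ∀ t ≥ (0 : ℝ), HasDerivAt x₂ (-gradient V (x₂ t)) t) :
    ∀ t ≥ (0 : ℝ), ‖x₁ t - x₂ t‖ ≤ Real.exp (-lam * t) * ‖x₁ 0 - x₂ 0‖ := by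
  exact fun t ht => norm_sub_le_exp_mul_of_stronglyMonotone
    (mul_norm_sub_sq_le_inner_of_le_inner_fderiv hV.differentiable_gradient hconv) hx₁ hx₂ ht
end
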